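/- Let $k\in\mathbb{N}$, $s\in(0,1)$, and $p,q\in[1,\infty)$. If there exists a constant $C>0$ such that for every $r\in(0,\infty)$ and every $f\in C_c^\infty(\mathbb{R}^n)$, $\left(\int_{\mathbb{R}^n}\left(\int_{B(\mathbf{0},r)}\frac{|\Delta_h^k f(x)|^q}{|h|^{n+skq}}\,dh\right)^{p/q}\,dx\right)^{1/p}\le C\,r^{(1-s)k}\,\||\nabla^k f|\|_{L^p}$, then $n(\frac{1}{p}-\frac{1}{q})\le k$. -/

import Mathlib

open MeasureTheory Real Set
open scoped Classical ENNReal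

noncomputable section

namespace Paper

variable {n : ℕ}

/-- The `k`-th order difference `Δ_h^k f (x)`. -/
def kdiff (k : ℕ) (f : EuclideanSpace ℝ (Fin n) → ℝ)
    (h x : EuclideanSpace ℝ (Fin n)) : ℝ :=
  ∑ j ∈ Finset.range (k + 1), (-1 : ℝ) ^ (k - j) * (k.choose j : ℝ) * f (x + j • h)

/-- Axis-parallel cubes. -/
def IsCube (Q : Set (EuclideanSpace ℝ (Fin n))) : Prop :=
  ∃ (a : EuclideanSpace ℝ (Fin n)) (l : ℝ), 0 < l ∧
    Q = {x | ∀ i, x i ∈ Set.Ico (a i) (a i + l)}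

/-- `ω` satisfies the `A₁` condition with constant `C`. -/
def MemA1 (ω : EuclideanSpace ℝ (Fin n) → ℝ) (C : ℝ) : Prop :=
  ∀ Q : Set (EuclideanSpace ℝ (Fin n)), IsCube Q →
    ∀ᵐ y ∂(volume.restrict Q), (⨍ x in Q, ω x) ≤ C * ω y

/-- `ω` satisfies the `A_p` condition (`p > 1`) with constant `C`. -/
def MemApGt (p : ℝ) (ω : EuclideanSpace ℝ (Fin n) → ℝ) (C : ℝ) : Prop :=
  ∀ Q : Set (EuclideanSpace ℝ (Fin n)), IsCube Q →
    IntegrableOn (fun x => ω x ^ (-1 / (p - 1))) Q volume ∧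
    (⨍ x in Q, ω x) * (⨍ x in Q, ω x ^ (-1 / (p - 1))) ^ (p - 1) ≤ C

/-- `A_p` condition for `p ∈ [1, ∞)`. -/
def MemAp (p : ℝ) (ω : EuclideanSpace ℝ (Fin n) → ℝ) (C : ℝ) : Prop :=
  if p = 1 then MemA1 ω C else MemApGt p ω C

/-- The Muckenhoupt constant `[ω]_{A_p}`. -/
def ApConst (p : ℝ) (ω : EuclideanSpace ℝ (Fin n) → ℝ) : ℝ :=
  sInf {C : ℝ | 0 ≤ C ∧ MemAp p ω C}

/-- `ω ∈ A_p`: nonnegative, locally integrable, satisfying the `A_p` condition. -/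
def IsAp (p : ℝ) (ω : EuclideanSpace ℝ (Fin n) → ℝ) : Prop :=
  (∀ x, 0 ≤ ω x) ∧ LocallyIntegrable ω volume ∧ ∃ C : ℝ, MemAp p ω C

/-- The `A₁` constant. -/
abbrev A1const (ω : EuclideanSpace ℝ (Fin n) → ℝ) : ℝ := ApConst 1 ω

/-- `ω ∈ A₁`. -/
abbrev IsA1 (ω : EuclideanSpace ℝ (Fin n) → ℝ) : Prop := IsAp 1 ω

/-- The critical exponent `p_ω := inf {r ∈ [1,∞) : ω ∈ A_r}`. -/
def pExp (ω : EuclideanSpace ℝ (Fin n) → ℝ) : ℝ :=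
  sInf {r : ℝ | 1 ≤ r ∧ IsAp r ω}

/-- Classical partial derivative in the `i`-th coordinate direction. -/
def pd (i : Fin n) (φ : EuclideanSpace ℝ (Fin n) → ℝ) :
    EuclideanSpace ℝ (Fin n) → ℝ :=
  fun x => fderiv ℝ φ x (EuclideanSpace.single i 1)

/-- The classical partial derivative `∂^α φ` for a multi-index `α`. -/
def pdMulti (α : Fin n → ℕ) (φ : EuclideanSpace ℝ (Fin n) → ℝ) :
    EuclideanSpace ℝ (Fin n) → ℝ :=
  (List.finRange n).foldr (fun i ψ => (pd i)^[α i] ψ) φ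

/-- `g` is the weak `α`-th partial derivative of `f`. -/
def HasWeakPD (α : Fin n → ℕ) (f g : EuclideanSpace ℝ (Fin n) → ℝ) : Prop :=
  ∀ φ : EuclideanSpace ℝ (Fin n) → ℝ, ContDiff ℝ (⊤ : ℕ∞) φ → HasCompactSupport φ →
    ∫ x, f x * pdMulti α φ x = (-1 : ℝ) ^ (∑ i, α i) * ∫ x, g x * φ x

/-- The multi-indices of order exactly `k`. -/
def multiIdx (n k : ℕ) : Finset (Fin n → ℕ) :=
  ((Finset.univ : Finset (Fin n → Fin (k + 1))).image fun a i => (a i : ℕ)).filter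
    fun α => ∑ i, α i = k

/-- The multi-indices of order at most `k`. -/
def multiIdxLE (n k : ℕ) : Finset (Fin n → ℕ) :=
  ((Finset.univ : Finset (Fin n → Fin (k + 1))).image fun a i => (a i : ℕ)).filter
    fun α => ∑ i, α i ≤ k

/-- `|∇^k f|` built from a family `g` of the `k`-th order (weak) partial derivatives. -/
def gradNorm (n k : ℕ) (g : (Fin n → ℕ) → EuclideanSpace ℝ (Fin n) → ℝ)
    (x : EuclideanSpace ℝ (Fin n)) : ℝ :=
  Real.sqrt (∑ α ∈ multiIdx n k, g α x ^ 2)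

end Paper

open Paper

theorem norm_fwdDiff_iter_le {E F : Type*} [NormedAddCommGroup E] [NormedSpace ℝ E]
    [NormedAddCommGroup F] [NormedSpace ℝ F] (k : ℕ) (h : E) (M : ℝ) (g : E → F)
    (hg : ContDiff ℝ k g) (hM : ∀ x, ‖iteratedFDeriv ℝ k g x‖ ≤ M) (x : E) :
    ‖(fwdDiff h)^[k] g x‖ ≤ M * ‖h‖ ^ k := by
  induction k generalizing M g x with
  | zero => simpa using hM x
  | succ k ih =>
    have hshift : ContDiff ℝ k (fun y => g (y + h)) :=
      (hg.of_le (by exact_mod_cast k.le_succ)).comp (contDiff_id.add contDiff_const)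
    have hg' : ContDiff ℝ k g := hg.of_le (by exact_mod_cast k.le_succ)
    rw [Function.iterate_succ_apply, pow_succ', ← mul_assoc]
    refine ih (M * ‖h‖) (fwdDiff h g) (hshift.sub hg') (fun y => ?_) x
    have hd : iteratedFDeriv ℝ k (fwdDiff h g) y
        = iteratedFDeriv ℝ k g (y + h) - iteratedFDeriv ℝ k g y := by
      change iteratedFDeriv ℝ k ((fun y => g (y + h)) - g) y = _
      rw [iteratedFDeriv_sub_apply hshift.contDiffAt hg'.contDiffAt, iteratedFDeriv_comp_add_right]
    rw [hd]
    have hmv := convex_univ.norm_image_sub_le_of_norm_fderiv_le (𝕜 := ℝ)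
      (f := iteratedFDeriv ℝ k g) (C := M) (x := y) (y := y + h)
      (fun z _ => (hg.differentiable_iteratedFDeriv (by exact_mod_cast k.lt_succ_self)) z)
      (fun z _ => by rw [norm_fderiv_iteratedFDeriv]; exact hM z) (mem_univ _) (mem_univ _)
    simpa using hmv

theorem kdiff_eq_fwdDiff_iter {n : ℕ} (k : ℕ) (f : EuclideanSpace ℝ (Fin n) → ℝ)
    (h x : EuclideanSpace ℝ (Fin n)) : kdiff k f h x = (fwdDiff h)^[k] f x := by
  simp [kdiff, fwdDiff_iter_eq_sum_shift]

theorem exists_abs_kdiff_le {n : ℕ} (k : ℕ) {f : EuclideanSpace ℝ (Fin n) → ℝ}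
    (hf : ContDiff ℝ (⊤ : ℕ∞) f) (hfc : HasCompactSupport f) :
    ∃ M : ℝ, 0 ≤ M ∧ ∀ h x, |kdiff k f h x| ≤ M * ‖h‖ ^ k := by
  obtain ⟨M, hM⟩ := (hf.continuous_iteratedFDeriv (m := k)
    (by exact_mod_cast le_top)).bounded_above_of_compact_support (hfc.iteratedFDeriv k)
  refine ⟨M, (norm_nonneg _).trans (hM 0), fun h x => ?_⟩
  rw [kdiff_eq_fwdDiff_iter]
  exact norm_fwdDiff_iter_le k h M f (hf.of_le (by exact_mod_cast le_top)) hM x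

theorem continuous_kdiff_uncurry {n : ℕ} (k : ℕ) {f : EuclideanSpace ℝ (Fin n) → ℝ}
    (hf : Continuous f) :
    Continuous fun z : EuclideanSpace ℝ (Fin n) × EuclideanSpace ℝ (Fin n) =>
      kdiff k f z.2 z.1 := by
  unfold kdiff
  fun_prop

/-- If `f` equals `1` on the unit ball and vanishes outside `B(0, 2)`, then only the last
node `x + k h` contributes to the difference when `h` is close to `-x / k`. -/
theorem kdiff_eq_one {n k : ℕ} (hk : 0 < k) {f : EuclideanSpace ℝ (Fin n) → ℝ}
    (hf1 : ∀ y, ‖y‖ ≤ 1 → f y = 1) (hf0 : ∀ y, 2 ≤ ‖y‖ → f y = 0)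
    {h x : EuclideanSpace ℝ (Fin n)} (hx : 3 * (k : ℝ) ≤ ‖x‖) (hh : ‖x + k • h‖ ≤ 1) :
    kdiff k f h x = 1 := by
  have hk' : (0 : ℝ) < k := by exact_mod_cast hk
  unfold kdiff
  rw [Finset.sum_range_succ, Finset.sum_eq_zero, hf1 _ hh]
  · simp
  intro j hj
  have hjk : (j : ℝ) + 1 ≤ k := by exact_mod_cast Finset.mem_range.mp hj
  rw [hf0, mul_zero]
  have e : (k : ℝ) • (x + j • h) = ((k : ℝ) - j) • x + (j : ℝ) • (x + k • h) := by
    simp only [← Nat.cast_smul_eq_nsmul ℝ]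
    module
  have h1 : ‖((k : ℝ) - j) • x‖ - ‖(j : ℝ) • (x + k • h)‖ ≤ ‖(k : ℝ) • (x + j • h)‖ := by
    rw [e]
    have := norm_sub_norm_le (((k : ℝ) - j) • x) (-((j : ℝ) • (x + k • h)))
    rwa [norm_neg, sub_neg_eq_add] at this
  rw [norm_smul, norm_smul, norm_smul, Real.norm_of_nonneg (by linarith), Real.norm_natCast,
    Real.norm_natCast] at h1
  have h2 : (j : ℝ) * ‖x + k • h‖ ≤ j * 1 := by gcongr
  have h3 : ‖x‖ ≤ ((k : ℝ) - j) * ‖x‖ := le_mul_of_one_le_left (norm_nonneg _) (by linarith)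
  by_contra! hlt
  nlinarith [mul_lt_mul_of_pos_left hlt hk']

theorem const_mul_measureReal_le_setIntegral {α : Type*} [MeasurableSpace α] {μ : Measure α}
    {g : α → ℝ} {S T : Set α} {c : ℝ} (hg : IntegrableOn g S μ) (hg0 : ∀ x, 0 ≤ g x)
    (hTS : T ⊆ S) (hT : MeasurableSet T) (hμT : μ T ≠ ∞) (hc : ∀ x ∈ T, c ≤ g x) :
    c * μ.real T ≤ ∫ x in S, g x ∂μ :=
  (setIntegral_ge_of_const_le_real hT hμT hc (hg.mono_set hTS)).trans
    (setIntegral_mono_set hg (.of_forall hg0) hTS.eventuallyLE)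

theorem le_of_rpow_le_mul_rpow {a b A R : ℝ}
    (h : ∀ r : ℝ, R ≤ r → r ^ a ≤ A * r ^ b) : a ≤ b := by
  by_contra! hlt
  obtain ⟨r, hr, hr1, hrA⟩ := ((Filter.eventually_ge_atTop R).and
    ((Filter.eventually_gt_atTop 0).and
      ((tendsto_rpow_atTop (sub_pos.mpr hlt)).eventually_gt_atTop A))).exists
  have := h r hr
  rw [rpow_sub hr1, lt_div_iff₀ (by positivity)] at hrA
  linarith

theorem rpow_div_rpow_le {t M u q a : ℝ} {k : ℕ} (hk : 0 < k) (hq : 0 < q) (ht : 0 ≤ t)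
    (hM : 0 ≤ M) (hu : 0 ≤ u) (h : t ≤ M * u ^ k) :
    t ^ q / u ^ a ≤ M ^ q * u ^ (-(a - k * q)) := by
  rcases hu.eq_or_lt with rfl | hu
  · rw [zero_pow hk.ne', mul_zero] at h
    rw [le_antisymm h ht, zero_rpow hq.ne', zero_div]
    positivity
  · calc t ^ q / u ^ a ≤ (M * u ^ k) ^ q / u ^ a := by gcongr
      _ = M ^ q * u ^ (-(a - k * q)) := by
        rw [mul_rpow hM (by positivity), ← rpow_natCast u k, ← rpow_mul hu.le, mul_div_assoc,
          ← rpow_sub hu, neg_sub]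

section DifferenceIntegral

variable {n k : ℕ} {q a : ℝ} {f : EuclideanSpace ℝ (Fin n) → ℝ}

theorem integrableOn_kdiff (hn : 0 < n) (hk : 0 < k) (hq : 0 < q) (ha : a - k * q < n)
    {M : ℝ} (hM : 0 ≤ M) (hf : Continuous f) (hfM : ∀ h x, |kdiff k f h x| ≤ M * ‖h‖ ^ k)
    (r : ℝ) (x : EuclideanSpace ℝ (Fin n)) :
    IntegrableOn (fun h => |kdiff k f h x| ^ q / ‖h‖ ^ a) (Metric.ball 0 r) := by
  refine integrableOn_ball_of_norm_le_rpow (C := M ^ q) (α := a - k * q)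
    (by rwa [finrank_euclideanSpace_fin])
    (by simpa using ha) (.of_forall fun h => ?_) ?_
  · rw [Real.norm_of_nonneg (by positivity)]
    exact rpow_div_rpow_le hk hq (abs_nonneg _) hM (norm_nonneg _) (hfM h x)
  · have := (continuous_kdiff_uncurry k hf).comp (Continuous.prodMk_right x)
    have hmeas : Measurable fun h => kdiff k f h x := this.measurable
    exact Measurable.aestronglyMeasurable (by fun_prop)

theorem integrable_integral_kdiff_rpow (hn : 0 < n) (hk : 0 < k) (hq : 0 < q)
    (ha : a - k * q < n) {M : ℝ} (hM : 0 ≤ M) (hf : Continuous f)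
    (hfM : ∀ h x, |kdiff k f h x| ≤ M * ‖h‖ ^ k) (hf0 : ∀ y, 2 ≤ ‖y‖ → f y = 0) (r : ℝ)
    {t : ℝ} (ht : 0 < t) :
    Integrable fun x => (∫ h in Metric.ball (0 : EuclideanSpace ℝ (Fin n)) r,
      |kdiff k f h x| ^ q / ‖h‖ ^ a) ^ t := by
  have hmeas : StronglyMeasurable fun x => (∫ h in Metric.ball (0 : EuclideanSpace ℝ (Fin n)) r,
      |kdiff k f h x| ^ q / ‖h‖ ^ a) := by
    have : Measurable fun z : EuclideanSpace ℝ (Fin n) × EuclideanSpace ℝ (Fin n) =>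
      kdiff k f z.2 z.1 := (continuous_kdiff_uncurry k hf).measurable
    have h2 : Measurable fun z : EuclideanSpace ℝ (Fin n) × EuclideanSpace ℝ (Fin n) =>
      |kdiff k f z.2 z.1| ^ q / ‖z.2‖ ^ a := by fun_prop
    exact h2.stronglyMeasurable.integral_prod_right
  set K : ℝ := ∫ h in Metric.ball (0 : EuclideanSpace ℝ (Fin n)) r,
    M ^ q * ‖h‖ ^ (-(a - k * q))
  have hK : IntegrableOn (fun h : EuclideanSpace ℝ (Fin n) => M ^ q * ‖h‖ ^ (-(a - k * q)))
      (Metric.ball 0 r) :=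
    integrableOn_ball_of_norm_le_rpow (C := M ^ q) (α := a - k * q)
    (by rwa [finrank_euclideanSpace_fin])
      (by simpa using ha)
      (.of_forall fun h => by rw [Real.norm_of_nonneg (by positivity)])
      (Measurable.aestronglyMeasurable (by fun_prop))
  have hI0 : ∀ x, 0 ≤ ∫ h in Metric.ball (0 : EuclideanSpace ℝ (Fin n)) r,
      |kdiff k f h x| ^ q / ‖h‖ ^ a := fun x => integral_nonneg fun h => by positivity
  have hIK : ∀ x, ∫ h in Metric.ball (0 : EuclideanSpace ℝ (Fin n)) r,
      |kdiff k f h x| ^ q / ‖h‖ ^ a ≤ K := fun x =>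
    setIntegral_mono (integrableOn_kdiff hn hk hq ha hM hf hfM r x) hK fun h =>
      rpow_div_rpow_le hk hq (abs_nonneg _) hM (norm_nonneg _) (hfM h x)
  have hon : IntegrableOn (fun x => (∫ h in Metric.ball (0 : EuclideanSpace ℝ (Fin n)) r,
      |kdiff k f h x| ^ q / ‖h‖ ^ a) ^ t) (Metric.ball 0 (2 + k * r)) := by
    refine Measure.integrableOn_of_bounded (M := K ^ t) measure_ball_lt_top.ne
      (hmeas.measurable.pow_const t).aestronglyMeasurable (.of_forall fun x => ?_)
    rw [Real.norm_of_nonneg (rpow_nonneg (hI0 x) _)]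
    exact rpow_le_rpow (hI0 x) (hIK x) ht.le
  refine (integrableOn_iff_integrable_of_support_subset fun x hx => ?_).mp hon
  rw [mem_ball_zero_iff]
  by_contra! hx2
  refine hx ?_
  change (∫ h in _, _) ^ t = 0
  rw [setIntegral_eq_zero_of_forall_eq_zero, zero_rpow ht.ne']
  intro h hh
  rw [mem_ball_zero_iff] at hh
  have : kdiff k f h x = 0 := Finset.sum_eq_zero fun j hj => by
    rw [hf0, mul_zero]
    have hjk : (j : ℝ) ≤ k := by exact_mod_cast Finset.mem_range_succ_iff.mp hj
    have h1 : ‖j • h‖ ≤ k * r := by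
      rw [← Nat.cast_smul_eq_nsmul ℝ, norm_smul, Real.norm_natCast]
      gcongr
    have := norm_sub_norm_le x (-(j • h))
    rw [norm_neg, sub_neg_eq_add] at this
    linarith
  simp [this, hq.ne']

theorem le_integral_kdiff (hn : 0 < n) (hk : 0 < k) (hq : 0 < q) (ha0 : 0 ≤ a)
    (ha : a - k * q < n) {M : ℝ} (hM : 0 ≤ M) (hf : Continuous f)
    (hfM : ∀ h x, |kdiff k f h x| ≤ M * ‖h‖ ^ k)
    (hf1 : ∀ y, ‖y‖ ≤ 1 → f y = 1) (hf0 : ∀ y, 2 ≤ ‖y‖ → f y = 0) {r : ℝ}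
    {x : EuclideanSpace ℝ (Fin n)} (hx : 3 * (k : ℝ) ≤ ‖x‖) (hxr : ‖x‖ + 1 ≤ r) :
    r ^ (-a) * volume.real (Metric.ball (0 : EuclideanSpace ℝ (Fin n)) (1 / k)) ≤
      ∫ h in Metric.ball (0 : EuclideanSpace ℝ (Fin n)) r, |kdiff k f h x| ^ q / ‖h‖ ^ a := by
  have hk' : (1 : ℝ) ≤ k := by exact_mod_cast hk
  have hT : ∀ h ∈ Metric.ball (-((1 / k : ℝ) • x)) (1 / k : ℝ), ‖x + k • h‖ < 1 := by
    intro h hh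
    rw [mem_ball_iff_norm, sub_neg_eq_add, lt_div_iff₀ (by linarith)] at hh
    have e : x + k • h = (k : ℝ) • (h + (1 / k : ℝ) • x) := by
      rw [smul_add, smul_smul, mul_one_div_cancel (by positivity), one_smul,
        Nat.cast_smul_eq_nsmul, add_comm]
    rw [e, norm_smul, Real.norm_natCast]
    linarith
  have hTr : ∀ h ∈ Metric.ball (-((1 / k : ℝ) • x)) (1 / k : ℝ), ‖h‖ < r := by
    intro h hh
    have h1 := hT h hh
    have h2 := norm_sub_norm_le (k • h) (-x)
    rw [norm_neg, sub_neg_eq_add, add_comm _ x, ← Nat.cast_smul_eq_nsmul ℝ, norm_smul,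
      Real.norm_natCast, Nat.cast_smul_eq_nsmul] at h2
    have := le_mul_of_one_le_left (norm_nonneg h) hk'
    linarith
  have hball : volume.real (Metric.ball (0 : EuclideanSpace ℝ (Fin n)) (1 / k)) =
      volume.real (Metric.ball (-((1 / k : ℝ) • x)) (1 / k : ℝ)) :=
    (Measure.addHaar_real_ball_center _ _ _).symm
  rw [hball]
  refine const_mul_measureReal_le_setIntegral (integrableOn_kdiff hn hk hq ha hM hf hfM r x)
    (fun h => by positivity) (fun h hh => by simpa using hTr h hh) measurableSet_ball
    measure_ball_lt_top.ne fun h hh => ?_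
  have hr : 0 < r := (norm_nonneg h).trans_lt (hTr h hh)
  rw [kdiff_eq_one hk hf1 hf0 hx (hT h hh).le, abs_one, one_rpow, rpow_neg hr.le, ← one_div]
  have hh0 : 0 < ‖h‖ := by
    rw [norm_pos_iff]
    rintro rfl
    have := hT 0 hh
    rw [smul_zero, add_zero] at this
    linarith
  have := rpow_le_rpow hh0.le (hTr h hh).le ha0
  gcongr

/-- The left side of the difference inequality grows at least like `r ^ (n / p - a / q)`. -/
theorem exists_pos_mul_rpow_le_integral_kdiff (hn : 0 < n) (hk : 0 < k) (hq : 0 < q)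
    (ha0 : 0 ≤ a) (ha : a - k * q < n) {p : ℝ} (hp : 0 < p) {M : ℝ} (hM : 0 ≤ M)
    (hf : Continuous f) (hfM : ∀ h x, |kdiff k f h x| ≤ M * ‖h‖ ^ k)
    (hf1 : ∀ y, ‖y‖ ≤ 1 → f y = 1) (hf0 : ∀ y, 2 ≤ ‖y‖ → f y = 0) :
    ∃ c : ℝ, 0 < c ∧ ∀ r : ℝ, 12 * k ≤ r → c * r ^ (n / p - a / q) ≤
      (∫ x, (∫ h in Metric.ball (0 : EuclideanSpace ℝ (Fin n)) r,
        |kdiff k f h x| ^ q / ‖h‖ ^ a) ^ (p / q)) ^ (1 / p) := by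
  have hk' : (1 : ℝ) ≤ k := by exact_mod_cast hk
  set v := volume.real (Metric.ball (0 : EuclideanSpace ℝ (Fin n)) (1 / k))
  set w := volume.real (Metric.ball (0 : EuclideanSpace ℝ (Fin n)) 1)
  have hv : 0 < v :=
    ENNReal.toReal_pos (Metric.measure_ball_pos _ _ (by positivity)).ne' measure_ball_lt_top.ne
  have hw : 0 < w :=
    ENNReal.toReal_pos (Metric.measure_ball_pos _ _ one_pos).ne' measure_ball_lt_top.ne
  refine ⟨v ^ (1 / q) * ((1 / 4 : ℝ) ^ n * w) ^ (1 / p), by positivity, fun r hr => ?_⟩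
  have hr0 : 0 < r := by linarith
  set e : EuclideanSpace ℝ (Fin n) := EuclideanSpace.single ⟨0, hn⟩ (r / 2)
  have he : ‖e‖ = r / 2 := by
    simp [e, abs_of_pos hr0]
  have hint := integrable_integral_kdiff_rpow hn hk hq ha hM hf hfM hf0 r (div_pos hp hq)
  have hlow := const_mul_measureReal_le_setIntegral (S := univ) (T := Metric.ball e (r / 4))
    (c := (r ^ (-a) * v) ^ (p / q)) hint.integrableOn
    (fun x => rpow_nonneg (integral_nonneg fun h => by positivity) _) (subset_univ _)
    measurableSet_ball measure_ball_lt_top.ne (fun x hx => by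
      rw [mem_ball_iff_norm] at hx
      have h1 := norm_sub_norm_le e x
      have h2 := norm_sub_norm_le x e
      rw [norm_sub_rev] at h1
      exact rpow_le_rpow (by positivity)
        (le_integral_kdiff hn hk hq ha0 ha hM hf hfM hf1 hf0 (by linarith) (by linarith))
        (by positivity))
  have hball : volume.real (Metric.ball e (r / 4)) = (r / 4) ^ n * w := by
    rw [Measure.real, Measure.addHaar_ball_of_pos _ _ (by positivity), ENNReal.toReal_mul,
      ENNReal.toReal_ofReal (by positivity), finrank_euclideanSpace_fin]
    rfl
  rw [setIntegral_univ, hball] at hlow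
  refine le_trans (le_of_eq ?_) (rpow_le_rpow (by positivity) hlow (by positivity))
  have hw' : (r / 4) ^ n * w = r ^ (n : ℝ) * ((1 / 4 : ℝ) ^ n * w) := by
    rw [rpow_natCast, ← mul_assoc, ← mul_pow]
    ring
  rw [hw', mul_rpow (x := (r ^ (-a) * v) ^ (p / q)) (by positivity) (by positivity),
    ← rpow_mul (by positivity),
    mul_rpow (x := r ^ (n : ℝ)) (by positivity) (by positivity),
    mul_rpow (x := r ^ (-a)) (by positivity) (by positivity), ← rpow_mul hr0.le,
    ← rpow_mul hr0.le, show p / q * (1 / p) = 1 / q by field_simp,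
    show (n : ℝ) / p - a / q = -a * (1 / q) + n * (1 / p) by ring, rpow_add hr0]
  ring

end DifferenceIntegral

/-- Proposition 6.1(i): necessity of the range `n(1/p - 1/q) ≤ k`. -/
theorem statement11 (n k : ℕ) (hn : 0 < n) (hk : 0 < k) (s p q C : ℝ)
    (hs : s ∈ Set.Ioo (0 : ℝ) 1) (hp : 1 ≤ p) (hq : 1 ≤ q) (hC : 0 < C)
    (H : ∀ r : ℝ, 0 < r → ∀ f : EuclideanSpace ℝ (Fin n) → ℝ,
      ContDiff ℝ (⊤ : ℕ∞) f → HasCompactSupport f →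
      (∫ x, (∫ h in Metric.ball (0 : EuclideanSpace ℝ (Fin n)) r,
          |kdiff k f h x| ^ q / ‖h‖ ^ ((n : ℝ) + s * k * q)) ^ (p / q)) ^ (1 / p) ≤
        C * r ^ ((1 - s) * (k : ℝ)) * (∫ x, ‖iteratedFDeriv ℝ k f x‖ ^ p) ^ (1 / p)) :
    (n : ℝ) * (1 / p - 1 / q) ≤ (k : ℝ) := by
  have hsk : 0 ≤ s * k * q := mul_nonneg (mul_nonneg hs.1.le k.cast_nonneg) (by linarith)
  have hkq : 0 < (1 - s) * (k * q) :=
    mul_pos (sub_pos.mpr hs.2) (mul_pos (by exact_mod_cast hk) (by linarith))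
  let b : ContDiffBump (0 : EuclideanSpace ℝ (Fin n)) := ⟨1, 2, one_pos, one_lt_two⟩
  have hb : ContDiff ℝ (⊤ : ℕ∞) b := b.contDiff
  obtain ⟨M, hM, hbM⟩ := exists_abs_kdiff_le k hb b.hasCompactSupport
  obtain ⟨c, hc, hlow⟩ := exists_pos_mul_rpow_le_integral_kdiff (p := p) (q := q)
    (a := n + s * k * q) hn hk (by linarith) (by positivity) (by linarith) (by linarith) hM
    hb.continuous hbM (fun y hy => b.one_of_mem_closedBall (by simpa [b] using hy))
    (fun y hy => b.zero_of_le_dist (by simpa [b] using hy))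
  have key : (n : ℝ) / p - (n + s * k * q) / q ≤ (1 - s) * k := by
    refine le_of_rpow_le_mul_rpow (R := 12 * k)
      (A := C * (∫ x, ‖iteratedFDeriv ℝ k b x‖ ^ p) ^ (1 / p) / c) fun r hr => ?_
    have hr0 : 0 < r := lt_of_lt_of_le (by positivity) hr
    have := (hlow r hr).trans (H r hr0 b hb b.hasCompactSupport)
    rw [div_mul_eq_mul_div, le_div_iff₀ hc]
    linarith
  have e : ((n : ℝ) + s * k * q) / q = n / q + s * k := by
    field_simp
  rw [e] at key
  rw [mul_sub, mul_one_div, mul_one_div]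
  linarith

end
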